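/- arXiv:2504.07534 — 7 statements merged into one kernel-verified Lean document; each statement's English description precedes it below -/
import Mathlib

section
/- For every n×n real matrix A and every integer k with 1 ≤ k ≤ n, trace(T_{k−1}(A)) = (n − k + 1) · σ_{k−1}(A). -/
/-- `σ_k(A)` is `(−1)^k` times the coefficient of `X^{n−k}` in the characteristic
polynomial of `A` (and `0` for `k > n`). -/
noncomputable def matSigma (n : ℕ) (A : Matrix (Fin n) (Fin n) ℝ) (k : ℕ) : ℝ :=
  if k ≤ n then (-1 : ℝ) ^ k * A.charpoly.coeff (n - k) else 0

/-- The `m`-th Newton tensor `T_m(A) = ∑_{j=0}^{m} (−1)^j σ_{m−j}(A) A^j`. -/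
noncomputable def newtonTensor (n : ℕ) (A : Matrix (Fin n) (Fin n) ℝ) (m : ℕ) :
    Matrix (Fin n) (Fin n) ℝ :=
  ∑ j ∈ Finset.range (m + 1), ((-1 : ℝ) ^ j * matSigma n A (m - j)) • A ^ j

open Polynomial in
/-- Jacobi's formula for the characteristic matrix. -/
theorem Matrix.derivative_charpoly_eq_trace_adjugate {ι R : Type*} [Fintype ι] [DecidableEq ι]
    [CommRing R] (A : Matrix ι ι R) :
    derivative A.charpoly = A.charmatrix.adjugate.trace := by
  have adjugate_diag (i : ι) : A.charmatrix.adjugate i i =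
      (A.charmatrix.updateCol i (Pi.single i 1)).det := by
    rw [← Matrix.transpose_apply A.charmatrix.adjugate, Matrix.adjugate_transpose,
      Matrix.adjugate_apply, Matrix.updateRow_transpose, Matrix.det_transpose]
  simp only [Matrix.trace, Matrix.diag_apply, adjugate_diag, Matrix.charpoly, Matrix.det_apply']
  rw [Finset.sum_comm, derivative_sum]
  refine Finset.sum_congr rfl fun σ _ => ?_
  rw [← Finset.mul_sum, derivative_intCast_mul, derivative_prod_finset]
  congr 1
  refine Finset.sum_congr rfl fun i _ => ?_
  rw [← Finset.prod_erase_mul _ _ (Finset.mem_univ i)]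
  congr 1
  · refine Finset.prod_congr rfl fun j hj => ?_
    rw [Matrix.updateCol_ne (Finset.ne_of_mem_erase hj)]
  · rw [Matrix.updateCol_self, Matrix.charmatrix_apply, Matrix.diagonal_apply, Pi.single_apply]
    split_ifs <;> simp

/-- Comparing coefficients in `(X - A) * adj (X - A) = charpoly A`. -/
theorem Matrix.coeff_adjugate_charmatrix {ι R : Type*} [Fintype ι] [DecidableEq ι]
    [CommRing R] (A : Matrix ι ι R) (m : ℕ) :
    A.charmatrix.adjugate.map (·.coeff m) =
      A.charpoly.coeff (m + 1) • (1 : Matrix ι ι R) +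
        A * A.charmatrix.adjugate.map (·.coeff (m + 1)) := by
  ext i j
  have h := congrArg (fun M => (M i j).coeff (m + 1)) A.charmatrix.mul_adjugate
  rw [Matrix.charmatrix, Matrix.sub_mul] at h
  simp only [Matrix.sub_apply, Polynomial.coeff_sub, Matrix.scalar_apply,
    Matrix.diagonal_mul, Polynomial.coeff_X_mul] at h
  rw [Matrix.mul_apply, Polynomial.finsetSum_coeff] at h
  simp only [RingHom.mapMatrix_apply, Matrix.map_apply, Polynomial.coeff_C_mul] at h
  rw [sub_eq_iff_eq_add] at h
  rw [Matrix.add_apply, Matrix.mul_apply]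
  simp only [Matrix.map_apply]
  refine h.trans ?_
  congr 1
  rw [Matrix.smul_apply, Matrix.smul_apply, Matrix.one_apply, Matrix.one_apply]
  split_ifs <;> simp [Matrix.charpoly, Matrix.charmatrix]

theorem Matrix.coeff_adjugate_charmatrix_eq_sum_add {ι R : Type*} [Fintype ι] [DecidableEq ι]
    [CommRing R] (A : Matrix ι ι R) (m N : ℕ) :
    A.charmatrix.adjugate.map (·.coeff m) =
      ∑ j ∈ Finset.range N, A.charpoly.coeff (m + 1 + j) • A ^ j +
        A ^ N * A.charmatrix.adjugate.map (·.coeff (m + N)) := by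
  induction N with
  | zero => simp
  | succ N ih =>
    rw [ih, Finset.sum_range_succ, A.coeff_adjugate_charmatrix (m + N), mul_add, pow_succ,
      mul_assoc, Matrix.mul_smul, mul_one, add_right_comm m 1 N, add_assoc m N 1, ← add_assoc]

theorem Matrix.coeff_adjugate_charmatrix_eq_sum {ι R : Type*} [Fintype ι] [DecidableEq ι]
    [CommRing R] (A : Matrix ι ι R) (m k : ℕ) (hk : Fintype.card ι ≤ m + k) :
    A.charmatrix.adjugate.map (·.coeff m) =
      ∑ j ∈ Finset.range k, A.charpoly.coeff (m + 1 + j) • A ^ j := by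
  nontriviality R
  obtain ⟨N, hN⟩ : ∃ N, ∀ i j, (A.charmatrix.adjugate i j).natDegree < N :=
    ⟨(∑ i, ∑ j, (A.charmatrix.adjugate i j).natDegree) + 1, fun i j => Nat.lt_succ_of_le <|
      (Finset.single_le_sum (f := fun j => (A.charmatrix.adjugate i j).natDegree)
        (fun _ _ => Nat.zero_le _) (Finset.mem_univ j)).trans
      (Finset.single_le_sum (f := fun i => ∑ j, (A.charmatrix.adjugate i j).natDegree)
        (fun _ _ => Nat.zero_le _) (Finset.mem_univ i))⟩
  have hzero : A.charmatrix.adjugate.map (·.coeff (m + (k + N))) = 0 := by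
    ext i j
    exact Polynomial.coeff_eq_zero_of_natDegree_lt ((hN i j).trans_le (by omega))
  rw [A.coeff_adjugate_charmatrix_eq_sum_add m (k + N), hzero, mul_zero, add_zero]
  refine (Finset.sum_subset (Finset.range_mono (Nat.le_add_right k N)) fun j _ hj => ?_).symm
  rw [Finset.mem_range, not_lt] at hj
  rw [Polynomial.coeff_eq_zero_of_natDegree_lt, zero_smul]
  rw [A.charpoly_natDegree_eq_dim]
  omega

theorem newtonTensor_eq_coeff_adjugate_charmatrix (n : ℕ) (A : Matrix (Fin n) (Fin n) ℝ)
    (m : ℕ) (hm : m < n) :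
    newtonTensor n A m =
      (-1 : ℝ) ^ m • A.charmatrix.adjugate.map (·.coeff (n - (m + 1))) := by
  rw [A.coeff_adjugate_charmatrix_eq_sum _ (m + 1) (by simp; omega), newtonTensor,
    Finset.smul_sum]
  refine Finset.sum_congr rfl fun j hj => ?_
  have hj' : j ≤ m := Nat.lt_succ_iff.mp (Finset.mem_range.mp hj)
  rw [matSigma, if_pos (by omega), ← mul_assoc, ← pow_add, smul_smul,
    Nat.add_sub_cancel' hj', show n - (m - j) = n - (m + 1) + 1 + j by omega]

theorem stmt_2 (n : ℕ) (A : Matrix (Fin n) (Fin n) ℝ) (k : ℕ)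
    (hk1 : 1 ≤ k) (hkn : k ≤ n) :
    (newtonTensor n A (k - 1)).trace = (n - k + 1 : ℕ) * matSigma n A (k - 1) := by
  have htrace : (A.charmatrix.adjugate.map (·.coeff (n - k))).trace =
      A.charpoly.coeff (n - k + 1) * ((n - k : ℕ) + 1) := by
    rw [← Polynomial.coeff_derivative, A.derivative_charpoly_eq_trace_adjugate, Matrix.trace,
      Matrix.trace, Polynomial.finsetSum_coeff]
    rfl
  rw [newtonTensor_eq_coeff_adjugate_charmatrix n A (k - 1) (by omega), Nat.sub_add_cancel hk1,
    Matrix.trace_smul, htrace, matSigma, if_pos (by omega),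
    show n - (k - 1) = n - k + 1 by omega, smul_eq_mul]
  push_cast
  ring
end

section
/- For every n×n real matrix A and every integer k with 1 ≤ k ≤ n, trace(T_{k−1}(A) · A²) = σ_1(A)·σ_k(A) − (k+1)·σ_{k+1}(A). -/
open Polynomial in
/-- **Jacobi's formula** for the derivative of the determinant of a polynomial matrix. -/
theorem Matrix.derivative_det {ι R : Type*} [Fintype ι] [DecidableEq ι] [CommRing R]
    (M : Matrix ι ι R[X]) :
    derivative M.det = (M.adjugate * M.map derivative).trace := by
  have h (i : ι) : (M.adjugate * M.map derivative) i i =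
      (M.updateCol i fun j => derivative (M j i)).det := by
    rw [← Matrix.cramer_apply, Matrix.cramer_eq_adjugate_mulVec]
    rfl
  simp only [Matrix.trace, Matrix.diag_apply, h, Matrix.det_apply, derivative_sum]
  rw [Finset.sum_comm]
  refine Finset.sum_congr rfl fun τ _ => ?_
  rw [Units.smul_def, derivative_smul, derivative_prod_finset, Finset.smul_sum]
  refine Finset.sum_congr rfl fun i _ => ?_
  rw [Units.smul_def, ← Finset.prod_erase_mul _ _ (Finset.mem_univ i)]
  congr 2
  · refine Finset.prod_congr rfl fun j hj => ?_
    rw [Matrix.updateCol_ne (Finset.ne_of_mem_erase hj)]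
  · rw [Matrix.updateCol_self]

namespace Matrix

open Polynomial

variable {ι R : Type*} [Fintype ι] [DecidableEq ι] [CommRing R] (A : Matrix ι ι R)

/-- The coefficient of `X ^ k` in the adjugate of `1 - X A`. -/
noncomputable def adjugateRevCoeff (k : ℕ) : Matrix ι ι R :=
  (adjugate (1 - (X : R[X]) • A.map C)).map fun p => p.coeff k

theorem coeff_adjugate_mul_map_C (k : ℕ) (i j : ι) :
    ((adjugate (1 - (X : R[X]) • A.map C) * A.map C : Matrix ι ι R[X]) i j).coeff k =
      (A.adjugateRevCoeff k * A) i j := by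
  simp [Matrix.mul_apply, adjugateRevCoeff]

theorem adjugate_sub_X_smul_adjugate_mul :
    adjugate (1 - (X : R[X]) • A.map C) -
      (X : R[X]) • (adjugate (1 - (X : R[X]) • A.map C) * A.map C) =
      A.charpolyRev • (1 : Matrix ι ι R[X]) := by
  rw [charpolyRev, ← adjugate_mul, mul_sub, mul_one, mul_smul_comm]

theorem adjugateRevCoeff_zero : A.adjugateRevCoeff 0 = A.charpolyRev.coeff 0 • 1 := by
  ext i j
  have h := congrArg (fun M : Matrix ι ι R[X] => (M i j).coeff 0)
    A.adjugate_sub_X_smul_adjugate_mul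
  rcases eq_or_ne i j with rfl | hij
  · simpa [adjugateRevCoeff] using h
  · simpa [adjugateRevCoeff, hij] using h

theorem adjugateRevCoeff_succ (k : ℕ) :
    A.adjugateRevCoeff (k + 1) =
      A.charpolyRev.coeff (k + 1) • 1 + A.adjugateRevCoeff k * A := by
  ext i j
  have h := congrArg (fun M : Matrix ι ι R[X] => (M i j).coeff (k + 1))
    A.adjugate_sub_X_smul_adjugate_mul
  simp only [sub_apply, smul_apply, coeff_sub, smul_eq_mul, coeff_X_mul,
    coeff_adjugate_mul_map_C] at h
  rw [add_apply, ← sub_eq_iff_eq_add]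
  refine h.trans ?_
  rcases eq_or_ne i j with rfl | hij
  · simp
  · simp [hij]

theorem adjugateRevCoeff_eq_sum (k : ℕ) :
    A.adjugateRevCoeff k =
      ∑ j ∈ Finset.range (k + 1), A.charpolyRev.coeff (k - j) • A ^ j := by
  induction k with
  | zero => simp [adjugateRevCoeff_zero]
  | succ k ih =>
    rw [adjugateRevCoeff_succ, ih, Finset.sum_range_succ' _ (k + 1), add_comm, Finset.sum_mul]
    simp [pow_succ]

theorem trace_adjugateRevCoeff_mul (k : ℕ) :
    (A.adjugateRevCoeff k * A).trace = -((k + 1) * A.charpolyRev.coeff (k + 1)) := by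
  have hd : (1 - (X : R[X]) • A.map C).map derivative = -A.map C := by
    ext1 i j
    rcases eq_or_ne i j with rfl | hij
    · simp
    · simp [hij]
  have h := congrArg (fun p : R[X] => p.coeff k) (derivative_det (1 - (X : R[X]) • A.map C))
  rw [hd, mul_neg, trace_neg] at h
  simp only [coeff_neg, trace, diag_apply, finsetSum_coeff, coeff_adjugate_mul_map_C,
    coeff_derivative] at h
  rw [trace, mul_comm, charpolyRev, h, neg_neg]
  rfl

end Matrix

theorem coeff_charpolyRev_eq_matSigma (n : ℕ) (A : Matrix (Fin n) (Fin n) ℝ) (k : ℕ) :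
    A.charpolyRev.coeff k = (-1) ^ k * matSigma n A k := by
  rw [← Matrix.reverse_charpoly, Polynomial.coeff_reverse, Matrix.charpoly_natDegree_eq_dim,
    Fintype.card_fin, matSigma]
  split_ifs with h
  · rw [Polynomial.revAt_le h, ← mul_assoc, ← mul_pow]
    simp
  · rw [Polynomial.revAt_eq_self_of_lt (not_le.mp h), mul_zero]
    exact Polynomial.coeff_eq_zero_of_natDegree_lt (by
      simpa [Matrix.charpoly_natDegree_eq_dim] using h)

theorem newtonTensor_eq_smul_adjugateRevCoeff (n : ℕ) (A : Matrix (Fin n) (Fin n) ℝ) (m : ℕ) :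
    newtonTensor n A m = (-1 : ℝ) ^ m • A.adjugateRevCoeff m := by
  rw [newtonTensor, Matrix.adjugateRevCoeff_eq_sum, Finset.smul_sum]
  refine Finset.sum_congr rfl fun j hj => ?_
  obtain ⟨i, rfl⟩ := Nat.exists_eq_add_of_le (Nat.lt_succ_iff.mp (Finset.mem_range.mp hj))
  rw [coeff_charpolyRev_eq_matSigma, smul_smul, Nat.add_sub_cancel_left, pow_add, ← mul_assoc,
    mul_assoc _ ((-1 : ℝ) ^ i) ((-1) ^ i), ← mul_pow (-1 : ℝ)]
  simp

theorem stmt_3 (n : ℕ) (A : Matrix (Fin n) (Fin n) ℝ) (k : ℕ)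
    (hk1 : 1 ≤ k) (hkn : k ≤ n) :
    (newtonTensor n A (k - 1) * A ^ 2).trace =
      matSigma n A 1 * matSigma n A k - (k + 1) * matSigma n A (k + 1) := by
  obtain ⟨m, rfl⟩ := Nat.exists_eq_add_of_le' hk1
  have hone : A.adjugateRevCoeff 0 = 1 := by
    rw [Matrix.adjugateRevCoeff_zero, coeff_charpolyRev_eq_matSigma]
    have := A.charpoly_monic.coeff_natDegree
    rw [Matrix.charpoly_natDegree_eq_dim, Fintype.card_fin] at this
    simp [matSigma, this]
  have h₁ := A.trace_adjugateRevCoeff_mul 0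
  have h₂ := A.trace_adjugateRevCoeff_mul (m + 1)
  rw [hone, one_mul] at h₁
  rw [Matrix.adjugateRevCoeff_succ, add_mul, Matrix.trace_add, smul_mul_assoc, one_mul,
    Matrix.trace_smul, h₁, mul_assoc, ← pow_two] at h₂
  simp only [coeff_charpolyRev_eq_matSigma, smul_eq_mul] at h₂
  rw [Nat.add_sub_cancel, newtonTensor_eq_smul_adjugateRevCoeff, smul_mul_assoc,
    Matrix.trace_smul, smul_eq_mul, eq_sub_of_add_eq' h₂]
  have hs : (-1 : ℝ) ^ m * (-1) ^ m = 1 := by rw [← mul_pow]; simp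
  push_cast
  simp only [zero_add, pow_succ, pow_zero]
  linear_combination (matSigma n A 1 * matSigma n A (m + 1) -
    (m + 1 + 1) * matSigma n A (m + 1 + 1)) * hs
end

section
/- (Newton's inequality.) Let n ≥ 2, let λ : Fin n → ℝ, and let k be an integer with 1 ≤ k ≤ n−1. Then e_{k−1}(λ) · e_{k+1}(λ) · C(n,k)² ≤ C(n,k−1) · C(n,k+1) · e_k(λ)², where C(n,k) denotes the binomial coefficient. Equivalently, with H_k(λ) := e_k(λ)/C(n,k), one has H_{k−1}(λ)·H_{k+1}(λ) ≤ H_k(λ)². -/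
/-- The `k`-th elementary symmetric polynomial of `λ₁,…,λₙ`. -/
noncomputable def esymm {n : ℕ} (l : Fin n → ℝ) (k : ℕ) : ℝ :=
  ∑ S ∈ (Finset.univ : Finset (Fin n)).powersetCard k, ∏ i ∈ S, l i

/-- The `k`-th elementary symmetric polynomial of the `n−1` values `(λ_j)_{j ≠ i}`. -/
noncomputable def esymmErase {n : ℕ} (l : Fin n → ℝ) (i : Fin n) (k : ℕ) : ℝ :=
  ∑ S ∈ ((Finset.univ : Finset (Fin n)).erase i).powersetCard k, ∏ j ∈ S, l j

open Polynomial in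
/-- Laguerre's inequality at the origin for a product of linear factors. -/
theorem coeff_prod_X_sub_C_laguerre (s : Multiset ℝ) :
    2 * (s.card : ℝ) * ((s.map fun r => X - C r).prod.coeff 0 *
        (s.map fun r => X - C r).prod.coeff 2) ≤
      ((s.card : ℝ) - 1) * (s.map fun r => X - C r).prod.coeff 1 ^ 2 := by
  induction s using Multiset.induction with
  | empty => simp [coeff_one]
  | cons r s ih =>
    rcases eq_or_ne s 0 with rfl | hs
    · simp [coeff_X, coeff_C]
    have hd : (0 : ℝ) < s.card := by exact_mod_cast Multiset.card_pos.2 hs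
    rw [Multiset.map_cons, Multiset.prod_cons, Multiset.card_cons]
    generalize (s.map fun r => X - C r).prod = q at ih ⊢
    have h0 : ((X - C r) * q).coeff 0 = -(r * q.coeff 0) := by simp [sub_mul]
    have h1 : ((X - C r) * q).coeff 1 = q.coeff 0 - r * q.coeff 1 := by
      simp [sub_mul, coeff_X_mul q 0]
    have h2 : ((X - C r) * q).coeff 2 = q.coeff 1 - r * q.coeff 2 := by
      simp [sub_mul, coeff_X_mul q 1]
    rw [h0, h1, h2]
    push_cast
    generalize (s.card : ℝ) = d at ih hd ⊢
    generalize q.coeff 0 = a at ih ⊢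
    generalize q.coeff 1 = b at ih ⊢
    generalize q.coeff 2 = c at ih ⊢
    refine le_of_mul_le_mul_left ?_ hd
    have key := mul_le_mul_of_nonneg_left ih (by positivity : 0 ≤ r ^ 2 * (d + 1))
    linarith [sq_nonneg (d * a + r * b)]

open Polynomial in
theorem Polynomial.Splits.derivative_real {p : ℝ[X]} (hp : p.Splits) :
    (derivative p).Splits := by
  rw [splits_iff_card_roots] at hp ⊢
  have h := card_roots_le_derivative p
  have h' := card_roots' (derivative p)
  rw [natDegree_derivative] at h' ⊢
  omega

open Polynomial in
/-- Newton's inequality for the coefficients of a real-rooted polynomial. -/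
theorem Polynomial.Splits.newton_coeff {p : ℝ[X]} (hp : p.Splits) {j d : ℕ}
    (hd : p.natDegree = j + d) :
    ((j : ℝ) + 2) * d * (p.coeff j * p.coeff (j + 2)) ≤
      ((j : ℝ) + 1) * ((d : ℝ) - 1) * p.coeff (j + 1) ^ 2 := by
  induction j generalizing p with
  | zero =>
    rw [zero_add, hp.natDegree_eq_card_roots] at hd
    have h := coeff_prod_X_sub_C_laguerre p.roots
    rw [hd] at h
    rw [hp.eq_prod_roots]
    simp only [coeff_C_mul, Nat.cast_zero, zero_add]
    linarith [mul_le_mul_of_nonneg_left h (sq_nonneg p.leadingCoeff)]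
  | succ j ih =>
    have h := ih hp.derivative_real (by rw [natDegree_derivative]; omega)
    simp only [coeff_derivative] at h
    push_cast at h ⊢
    refine le_of_mul_le_mul_left ?_ (by positivity : (0 : ℝ) < (j + 1) * (j + 2))
    linarith

open Polynomial in
theorem coeff_prod_X_add_C_eq_esymm {n : ℕ} (l : Fin n → ℝ) {i k : ℕ} (h : i + k = n) :
    (∏ x, (X + C (l x))).coeff i = esymm l k := by
  rw [Finset.prod_X_add_C_coeff _ _ (by simp; omega), esymm, Finset.card_univ, Fintype.card_fin,
    show n - i = k by omega]

open Polynomial in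
theorem stmt_9 (n : ℕ) (hn : 2 ≤ n) (l : Fin n → ℝ) (k : ℕ)
    (hk1 : 1 ≤ k) (hkn : k ≤ n - 1) :
    esymm l (k - 1) * esymm l (k + 1) * (n.choose k : ℝ) ^ 2 ≤
      (n.choose (k - 1) : ℝ) * (n.choose (k + 1) : ℝ) * (esymm l k) ^ 2 := by
  obtain ⟨m, rfl⟩ := Nat.exists_eq_add_of_le' hk1
  obtain ⟨j, rfl⟩ : ∃ j, n = j + m + 2 := ⟨n - m - 2, by omega⟩
  have hs : (∏ x, (X + C (l x))).Splits :=
    Splits.prod fun x _ => Splits.X_add_C (l x)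
  have h := hs.newton_coeff (j := j) (d := m + 2) (by
    rw [natDegree_prod_of_monic _ _ fun x _ => monic_X_add_C (l x)]
    simp [add_assoc])
  rw [coeff_prod_X_add_C_eq_esymm l (i := j) (k := m + 2) (by omega),
    coeff_prod_X_add_C_eq_esymm l (i := j + 1) (k := m + 1) (by omega),
    coeff_prod_X_add_C_eq_esymm l (i := j + 2) (k := m) (by omega)] at h
  have c1 := Nat.choose_succ_right_eq (j + m + 2) m
  have c2 := Nat.choose_succ_right_eq (j + m + 2) (m + 1)
  rw [show j + m + 2 - m = j + 2 by omega] at c1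
  rw [show j + m + 2 - (m + 1) = j + 1 by omega] at c2
  rw [Nat.add_sub_cancel]
  apply_fun ((↑) : ℕ → ℝ) at c1 c2
  push_cast at c1 c2 h
  simp only [add_assoc, one_add_one_eq_two] at *
  generalize ((j + (m + 2)).choose m : ℝ) = a at *
  generalize ((j + (m + 2)).choose (m + 1) : ℝ) = b at *
  generalize ((j + (m + 2)).choose (m + 2) : ℝ) = c at *
  refine le_of_mul_le_mul_left ?_ (by positivity : (0 : ℝ) < (j + 2) * (m + 2))
  calc _ = b ^ 2 * (((j : ℝ) + 2) * (m + 2) * (esymm l (m + 2) * esymm l m)) := by ring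
    _ ≤ b ^ 2 * (((j : ℝ) + 1) * (m + 2 - 1) * esymm l (m + 1) ^ 2) :=
      mul_le_mul_of_nonneg_left h (sq_nonneg b)
    _ = (b * (m + 1)) * (b * (j + 1)) * esymm l (m + 1) ^ 2 := by ring
    _ = _ := by rw [c1, ← c2]; ring
end

section
/- (Maclaurin's inequality.) Let n ≥ 2, let λ : Fin n → ℝ with λ_i > 0 for all i, and let k be an integer with 1 ≤ k ≤ n−1. Then (H_{k+1}(λ))^{1/(k+1)} ≤ (H_k(λ))^{1/k}, where H_k(λ) := e_k(λ)/C(n,k). -/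
/-- The normalized `k`-th elementary symmetric polynomial of the values `f i`, `i ∈ s`. -/
noncomputable def esymmMean {ι : Type*} (s : Finset ι) (f : ι → ℝ) (k : ℕ) : ℝ :=
  (∑ S ∈ s.powersetCard k, ∏ i ∈ S, f i) / (s.card.choose k : ℝ)

section esymmMean

variable {ι : Type*} {s : Finset ι} {f : ι → ℝ}

lemma esymmMean_zero : esymmMean s f 0 = 1 := by
  simp [esymmMean]

lemma esymmMean_of_card_lt {k : ℕ} (hk : s.card < k) : esymmMean s f k = 0 := by
  simp [esymmMean, Nat.choose_eq_zero_of_lt hk]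

lemma esymmMean_pos (hf : ∀ i, 0 < f i) {k : ℕ} (hk : k ≤ s.card) : 0 < esymmMean s f k := by
  refine div_pos (Finset.sum_pos (fun _ _ => Finset.prod_pos fun i _ => hf i) ?_) ?_
  · exact Finset.powersetCard_nonempty.2 hk
  · exact_mod_cast Nat.choose_pos hk

lemma esymmMean_nonneg (hf : ∀ i, 0 < f i) (k : ℕ) : 0 ≤ esymmMean s f k :=
  div_nonneg (Finset.sum_nonneg fun _ _ => Finset.prod_nonneg fun i _ => (hf i).le)
    (Nat.cast_nonneg _)

lemma esymmMean_insert [DecidableEq ι] {a : ι} (ha : a ∉ s) {k : ℕ} (hk : k ≤ s.card) :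
    (s.card + 1 : ℝ) * esymmMean (insert a s) f (k + 1) =
      (s.card - k) * esymmMean s f (k + 1) + (k + 1) * f a * esymmMean s f k := by
  have hsum : ∑ S ∈ (insert a s).powersetCard (k + 1), ∏ i ∈ S, f i =
      ∑ S ∈ s.powersetCard (k + 1), ∏ i ∈ S, f i +
        f a * ∑ S ∈ s.powersetCard k, ∏ i ∈ S, f i := by
    simp only [← Finset.esymm_map_val, Finset.insert_val_of_notMem ha, Multiset.map_cons,
      Multiset.esymm, Multiset.powersetCard_cons, Multiset.map_add, Multiset.sum_add,
      Multiset.map_map, Function.comp_def, Multiset.prod_cons, Multiset.sum_map_mul_left]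
  have hpos : (0 : ℝ) < s.card.choose k := by exact_mod_cast Nat.choose_pos hk
  have hpos' : (0 : ℝ) < (s.card + 1).choose (k + 1) := by
    exact_mod_cast Nat.choose_pos (Nat.succ_le_succ hk)
  have hchoose : (s.card + 1 : ℝ) * s.card.choose k = (s.card + 1).choose (k + 1) * (k + 1) := by
    exact_mod_cast Nat.add_one_mul_choose_eq s.card k
  have hfst : (s.card + 1 : ℝ) * ((∑ S ∈ s.powersetCard (k + 1), ∏ i ∈ S, f i) /
      (s.card + 1).choose (k + 1)) = (s.card - k) * esymmMean s f (k + 1) := by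
    rcases hk.eq_or_lt with rfl | hlt
    · simp
    · have hpos'' : (0 : ℝ) < s.card.choose (k + 1) := by exact_mod_cast Nat.choose_pos hlt
      have h := Nat.choose_mul_succ_eq s.card (k + 1)
      rw [Nat.add_sub_add_right] at h
      have h' : (s.card.choose (k + 1) : ℝ) * (s.card + 1) =
          (s.card + 1).choose (k + 1) * (s.card - k) := by
        rw [← Nat.cast_sub hk]
        exact_mod_cast h
      rw [esymmMean]
      field_simp
      linear_combination (∑ S ∈ s.powersetCard (k + 1), ∏ i ∈ S, f i) * h'
  have hsnd : (s.card + 1 : ℝ) * ((f a * ∑ S ∈ s.powersetCard k, ∏ i ∈ S, f i) /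
      (s.card + 1).choose (k + 1)) = (k + 1) * f a * esymmMean s f k := by
    rw [esymmMean]
    field_simp
    linear_combination f a * (∑ S ∈ s.powersetCard k, ∏ i ∈ S, f i) * hchoose
  rw [esymmMean, hsum, Finset.card_insert_of_notMem ha, add_div, mul_add, hfst, hsnd]

/-- Newton's inequality for positive reals. -/
theorem esymmMean_mul_le_sq (hf : ∀ i, 0 < f i) (k : ℕ) :
    esymmMean s f k * esymmMean s f (k + 2) ≤ esymmMean s f (k + 1) ^ 2 := by
  classical
  induction s using Finset.induction_on generalizing k with
  | empty => simp [esymmMean_of_card_lt (s := (∅ : Finset ι)) (f := f) (k := k + 2) (by simp),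
      sq_nonneg]
  | insert a s ha ih =>
    rcases lt_or_ge s.card (k + 1) with hlt | hle
    · rw [esymmMean_of_card_lt (k := k + 2) (by rw [Finset.card_insert_of_notMem ha]; omega),
        mul_zero]
      exact sq_nonneg _
    have hrec₁ := esymmMean_insert (f := f) ha (k := k) (by omega)
    have hrec₂ := esymmMean_insert (f := f) ha hle
    have hx := hf a
    have hn : (k + 1 : ℝ) ≤ s.card := by exact_mod_cast hle
    have hk : (0 : ℝ) ≤ k := k.cast_nonneg
    have hN : (0 : ℝ) < (s.card + 1 : ℝ) ^ 2 := by positivity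
    have hnewton := ih k
    have hp₀ := esymmMean_pos (s := s) hf (k := k) (by omega)
    have hp₁ := esymmMean_pos (s := s) hf hle
    have hq := esymmMean_nonneg (s := s) hf (k + 2)
    push_cast at hrec₂
    refine le_of_mul_le_mul_left ?_ hN
    rw [← mul_pow, hrec₁]
    have hm : (0 : ℝ) ≤ (s.card - k) ^ 2 - 1 := by nlinarith
    have hconst := mul_nonneg hm (sub_nonneg.2 hnewton)
    rcases k with _ | j
    · simp only [esymmMean_zero, Nat.cast_zero, zero_add] at *
      have hprod : (s.card + 1 : ℝ) ^ 2 * (1 * esymmMean (insert a s) f 2) =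
          (s.card + 1) * ((s.card - 1) * esymmMean s f 2 + (1 + 1) * f a * esymmMean s f 1) := by
        rw [← hrec₂]; ring
      rw [hprod]
      nlinarith [sq_nonneg (esymmMean s f 1 - f a)]
    · have hrec₀ := esymmMean_insert (f := f) ha (k := j) (by omega)
      have hnewton' := ih j
      have hr := esymmMean_nonneg (s := s) hf j
      simp only [add_assoc, Nat.reduceAdd] at *
      have hcross : esymmMean s f j * esymmMean s f (j + 3) ≤
          esymmMean s f (j + 1) * esymmMean s f (j + 2) := by
        refine le_of_mul_le_mul_left ?_ (mul_pos hp₀ hp₁)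
        have := mul_le_mul hnewton' hnewton (mul_nonneg hp₀.le hq) (sq_nonneg _)
        linarith
      have hprod : (s.card + 1 : ℝ) ^ 2 *
          (esymmMean (insert a s) f (j + 1) * esymmMean (insert a s) f (j + 3)) =
          ((s.card + 1) * esymmMean (insert a s) f (j + 1)) *
            ((s.card + 1) * esymmMean (insert a s) f (j + 3)) := by ring
      rw [hprod, hrec₀, hrec₂]
      push_cast at *
      have hj : (0 : ℝ) ≤ j := j.cast_nonneg
      have hlin := mul_nonneg (mul_nonneg (mul_nonneg (by linarith : (0 : ℝ) ≤ j + 1)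
        (by linarith : (0 : ℝ) ≤ s.card - j - 2)) hx.le) (sub_nonneg.2 hcross)
      have hquad := mul_nonneg (mul_nonneg (by nlinarith : (0 : ℝ) ≤ (j + 2) ^ 2 - 1)
        (sq_nonneg (f a))) (sub_nonneg.2 hnewton')
      linarith [sq_nonneg (esymmMean s f (j + 2) - f a * esymmMean s f (j + 1))]

/-- Maclaurin's inequality with natural exponents. -/
theorem esymmMean_succ_pow_le (hf : ∀ i, 0 < f i) {k : ℕ} (hk : k ≤ s.card) :
    esymmMean s f (k + 1) ^ k ≤ esymmMean s f k ^ (k + 1) := by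
  induction k with
  | zero => simp [esymmMean_zero]
  | succ k ih =>
    have hp := esymmMean_pos (s := s) hf (k := k) (by omega)
    have hp' := esymmMean_pos (s := s) hf hk
    refine le_of_mul_le_mul_left ?_ (pow_pos hp (k + 1))
    calc esymmMean s f k ^ (k + 1) * esymmMean s f (k + 2) ^ (k + 1)
        = (esymmMean s f k * esymmMean s f (k + 2)) ^ (k + 1) := (mul_pow _ _ _).symm
      _ ≤ (esymmMean s f (k + 1) ^ 2) ^ (k + 1) :=
        pow_le_pow_left₀ (mul_nonneg hp.le (esymmMean_nonneg hf _)) (esymmMean_mul_le_sq hf k) _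
      _ = esymmMean s f (k + 1) ^ k * esymmMean s f (k + 1) ^ (k + 2) := by ring
      _ ≤ esymmMean s f k ^ (k + 1) * esymmMean s f (k + 1) ^ (k + 2) :=
        mul_le_mul_of_nonneg_right (ih (by omega)) (pow_pos hp' _).le

end esymmMean

theorem stmt_10 (n : ℕ) (hn : 2 ≤ n) (l : Fin n → ℝ) (hl : ∀ i, 0 < l i)
    (k : ℕ) (hk1 : 1 ≤ k) (hkn : k ≤ n - 1) :
    (esymm l (k + 1) / (n.choose (k + 1) : ℝ)) ^ ((1 : ℝ) / (k + 1)) ≤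
      (esymm l k / (n.choose k : ℝ)) ^ ((1 : ℝ) / k) := by
  have hmean (j : ℕ) : esymm l j / (n.choose j : ℝ) = esymmMean Finset.univ l j := by
    simp [esymm, esymmMean]
  rw [hmean, hmean]
  have h := esymmMean_succ_pow_le (s := Finset.univ) hl (k := k) (by simp; omega)
  have ha := esymmMean_nonneg (s := Finset.univ) hl (k + 1)
  have hb := esymmMean_nonneg (s := Finset.univ) hl k
  have hk : (0 : ℝ) < k := by exact_mod_cast hk1
  have hpow := Real.rpow_le_rpow (pow_nonneg ha k) h
    (by positivity : (0 : ℝ) ≤ 1 / (k * (k + 1)))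
  rw [← Real.rpow_natCast, ← Real.rpow_natCast, ← Real.rpow_mul ha, ← Real.rpow_mul hb] at hpow
  convert hpow using 2
  · field_simp
  · push_cast
    field_simp
end

section
/- Let n ≥ 2, let λ : Fin n → ℝ with λ_i > 0 for all i, let k be an integer with 1 ≤ k ≤ n, and suppose e_k(λ) = C(n,k). Then e_{k−1}(λ) ≥ C(n,k−1). Moreover, if 2 ≤ k, then equality holds if and only if λ_i = 1 for all i. -/
open Polynomial

/-- Pascal-type recursion for elementary symmetric functions of a multiset. -/
theorem Multiset.esymm_cons {R : Type*} [CommSemiring R] (a : R) (s : Multiset R) (k : ℕ) :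
    (a ::ₘ s).esymm (k + 1) = s.esymm (k + 1) + a * s.esymm k := by
  simp [Multiset.esymm, Multiset.powersetCard_cons, Multiset.sum_map_mul_left]

theorem Multiset.esymm_card {R : Type*} [CommSemiring R] (s : Multiset R) :
    s.esymm (card s) = s.prod := by
  simp [Multiset.esymm, Multiset.powersetCard_self]

theorem Multiset.esymm_eq_prod_mul_sum_inv {K : Type*} [Field K] (s : Multiset K)
    (hs : ∀ x ∈ s, x ≠ 0) {m : ℕ} (hm : card s = m + 1) :
    s.esymm m = s.prod * (s.map fun x => x⁻¹).sum := by
  induction s using Multiset.induction generalizing m with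
  | empty => simp at hm
  | cons a s ih =>
    have ha : a ≠ 0 := hs a (mem_cons_self a s)
    have hm' : card s = m := by simpa using hm
    cases m with
    | zero =>
      rw [card_eq_zero.mp hm']
      simp [Multiset.esymm, ha]
    | succ m =>
      rw [esymm_cons, ih (fun x hx => hs x (mem_cons_of_mem hx)) hm', ← hm', esymm_card]
      simp
      field_simp

theorem Multiset.sq_sum_eq {R : Type*} [CommSemiring R] (s : Multiset R) :
    s.sum ^ 2 = (s.map (· ^ 2)).sum + 2 * s.esymm 2 := by
  induction s using Multiset.induction with
  | empty => simp [Multiset.esymm, Multiset.powersetCard_zero_right]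
  | cons a s ih =>
    have h1 : s.esymm 1 = s.sum := by simp [Multiset.esymm, Multiset.powersetCard_one]
    rw [esymm_cons, h1, sum_cons, map_cons, sum_cons, add_sq, ih]
    ring

theorem Multiset.esymm_nonneg (s : Multiset ℝ) (hs : ∀ x ∈ s, 0 < x) (k : ℕ) : 0 ≤ s.esymm k := by
  refine sum_nonneg ?_
  simp only [mem_map]
  rintro _ ⟨t, ht, rfl⟩
  exact prod_nonneg fun x hx => (hs x (mem_of_le (mem_powersetCard.mp ht).1 hx)).le

theorem Multiset.esymm_pos (s : Multiset ℝ) (hs : ∀ x ∈ s, 0 < x) {k : ℕ} (hk : k ≤ card s) :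
    0 < s.esymm k := by
  induction s using Multiset.induction generalizing k with
  | empty => simp_all [Multiset.esymm]
  | cons a s ih =>
    have hs' : ∀ x ∈ s, 0 < x := fun x hx => hs x (mem_cons_of_mem hx)
    cases k with
    | zero => simp [Multiset.esymm]
    | succ k =>
      rw [esymm_cons]
      exact add_pos_of_nonneg_of_pos (s.esymm_nonneg hs' _)
        (mul_pos (hs a (mem_cons_self a s)) (ih hs' (by simpa using hk)))

theorem Multiset.sum_map_inv_sub_one_add_log (s : Multiset ℝ) (hs : ∀ x ∈ s, 0 < x) :
    (s.map fun x => x⁻¹ - 1 + Real.log x).sum =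
      (s.map fun x => x⁻¹).sum - card s + Real.log s.prod := by
  induction s using Multiset.induction with
  | empty => simp
  | cons a s ih =>
    have hs' : ∀ x ∈ s, 0 < x := fun x hx => hs x (mem_cons_of_mem hx)
    simp only [map_cons, sum_cons, prod_cons, card_cons, ih hs',
      Real.log_mul (hs a (mem_cons_self a s)).ne' (prod_pos hs').ne']
    push_cast
    ring

theorem Real.inv_sub_one_add_log_nonneg {x : ℝ} (hx : 0 < x) : 0 ≤ x⁻¹ - 1 + Real.log x := by
  have := Real.log_le_sub_one_of_pos (inv_pos.mpr hx)
  rw [Real.log_inv] at this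
  linarith

theorem Real.eq_one_of_inv_sub_one_add_log_eq_zero {x : ℝ} (hx : 0 < x)
    (h : x⁻¹ - 1 + Real.log x = 0) : x = 1 := by
  by_contra hne
  have := Real.log_lt_sub_one_of_pos (inv_pos.mpr hx) (by simpa using hne)
  rw [Real.log_inv] at this
  linarith

/-- The AM-GM inequality for the reciprocals of positive numbers with product one. -/
theorem Multiset.card_le_sum_map_inv (s : Multiset ℝ) (hs : ∀ x ∈ s, 0 < x) (hp : s.prod = 1) :
    (card s : ℝ) ≤ (s.map fun x => x⁻¹).sum := by
  have h := s.sum_map_inv_sub_one_add_log hs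
  have h0 : 0 ≤ (s.map fun x => x⁻¹ - 1 + Real.log x).sum :=
    sum_nonneg <| by
      simp only [mem_map]
      rintro _ ⟨x, hx, rfl⟩
      exact Real.inv_sub_one_add_log_nonneg (hs x hx)
  rw [hp, Real.log_one] at h
  linarith

theorem Multiset.eq_one_of_sum_map_inv_eq_card (s : Multiset ℝ) (hs : ∀ x ∈ s, 0 < x)
    (hp : s.prod = 1) (h : (s.map fun x => x⁻¹).sum = card s) : ∀ x ∈ s, x = 1 := by
  intro x hx
  refine Real.eq_one_of_inv_sub_one_add_log_eq_zero (hs x hx) (le_antisymm ?_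
    (Real.inv_sub_one_add_log_nonneg (hs x hx)))
  have h0 := s.sum_map_inv_sub_one_add_log hs
  rw [hp, Real.log_one, h, sub_self, add_zero] at h0
  rw [← h0]
  refine single_le_sum ?_ _ (mem_map_of_mem _ hx)
  simp only [mem_map]
  rintro _ ⟨y, hy, rfl⟩
  exact Real.inv_sub_one_add_log_nonneg (hs y hy)

/-- The derivative of `∏ (X + aᵢ)` with all `aᵢ > 0` is again, up to a constant, of this form. -/
theorem exists_derivative_prod_X_add_C_eq (s : Multiset ℝ) (hs : ∀ x ∈ s, 0 < x) {n : ℕ}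
    (hn : s.card = n + 1) :
    ∃ t : Multiset ℝ, t.card = n ∧ (∀ x ∈ t, 0 < x) ∧
      derivative (s.map fun a => X + C a).prod =
        C ((n : ℝ) + 1) * (t.map fun a => X + C a).prod := by
  set p : ℝ[X] := (s.map fun a => X + C a).prod with hp
  have hdeg : p.natDegree = n + 1 := by
    rw [hp, natDegree_multiset_prod_of_monic _ (by simp +contextual [monic_X_add_C])]
    simp [hn, add_comm]
  have hmonic : p.Monic := monic_multiset_prod_of_monic _ _ fun a _ => monic_X_add_C a
  have hroots : p.roots.card = n + 1 := by
    have : p = ((s.map Neg.neg).map fun a => X - C a).prod := by simp [hp]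
    rw [this, roots_multiset_prod_X_sub_C, Multiset.card_map, hn]
  have hcoeff : (derivative p).coeff n = n + 1 := by
    rw [coeff_derivative, ← hdeg, hmonic.coeff_natDegree, one_mul]
  have hdeg' : (derivative p).natDegree = n := by
    refine le_antisymm ((natDegree_derivative_le p).trans (by omega)) (le_natDegree_of_ne_zero ?_)
    rw [hcoeff]
    positivity
  have hroots' : (derivative p).roots.card = n := by
    have h1 := card_roots_le_derivative p
    have h2 := card_roots' (derivative p)
    omega
  refine ⟨(derivative p).roots.map Neg.neg, by simpa using hroots', ?_, ?_⟩
  · simp only [Multiset.mem_map]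
    rintro _ ⟨r, hr, rfl⟩
    by_contra! hr0
    have hr1 : 0 ≤ r := by linarith
    have hev : 0 < (derivative p).eval r := by
      rw [eval_eq_sum_range, hdeg']
      have hpos : ∀ j ≤ n, 0 < (derivative p).coeff j := fun j hj => by
        rw [coeff_derivative, hp, Multiset.prod_X_add_C_coeff s (by omega)]
        exact mul_pos (s.esymm_pos hs (Nat.sub_le _ _)) (by positivity)
      rw [Finset.sum_range_succ']
      refine add_pos_of_nonneg_of_pos (Finset.sum_nonneg fun j hj => ?_) ?_
      · exact mul_nonneg (hpos _ (by simpa using hj)).le (by positivity)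
      · simpa using hpos 0 (by omega)
    exact hev.ne' (isRoot_of_mem_roots hr)
  · have h := C_leadingCoeff_mul_prod_multiset_X_sub_C (p := derivative p) (by omega)
    rw [leadingCoeff, hdeg', hcoeff] at h
    simpa [Multiset.map_map, Function.comp_def, sub_eq_add_neg] using h.symm

theorem Multiset.exists_esymm_mul_choose_eq_succ (s : Multiset ℝ) (hs : ∀ x ∈ s, 0 < x) {n : ℕ}
    (hn : card s = n + 1) :
    ∃ t : Multiset ℝ, card t = n ∧ (∀ x ∈ t, 0 < x) ∧
      ∀ j ≤ n, t.esymm j * (n + 1).choose j = s.esymm j * n.choose j := by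
  obtain ⟨t, ht, htpos, h⟩ := exists_derivative_prod_X_add_C_eq s hs hn
  refine ⟨t, ht, htpos, fun j hj => ?_⟩
  have hc := congrArg (fun q => q.coeff (n - j)) h
  simp only [coeff_derivative, coeff_C_mul] at hc
  rw [prod_X_add_C_coeff s (by omega), prod_X_add_C_coeff t (by omega), hn, ht,
    show n + 1 - (n - j + 1) = j by omega, show n - (n - j) = j by omega, Nat.cast_sub hj] at hc
  have hb : (n.choose j : ℝ) * (n + 1) = (n + 1).choose j * (n - j + 1) := by
    have := Nat.choose_mul_succ_eq n j
    rw [show n + 1 - j = n - j + 1 by omega] at this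
    rw [← Nat.cast_sub hj]
    exact_mod_cast this
  have h0 : (n : ℝ) + 1 ≠ 0 := by positivity
  apply mul_left_cancel₀ h0
  linear_combination (-((n + 1).choose j : ℝ)) * hc - s.esymm j * hb

/-- Positive numbers `s` can be replaced by `k ≤ card s` positive numbers with the same
normalized elementary symmetric functions of degree at most `k`. -/
theorem Multiset.exists_esymm_mul_choose_eq (s : Multiset ℝ) (hs : ∀ x ∈ s, 0 < x) {k : ℕ}
    (hk : k ≤ card s) :
    ∃ t : Multiset ℝ, card t = k ∧ (∀ x ∈ t, 0 < x) ∧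
      ∀ j ≤ k, t.esymm j * (card s).choose j = s.esymm j * k.choose j := by
  induction hk using Nat.decreasingInduction with
  | self => exact ⟨s, rfl, hs, fun _ _ => rfl⟩
  | of_succ k hk ih =>
    obtain ⟨t, ht, htpos, h⟩ := ih
    obtain ⟨u, hu, hupos, h'⟩ := t.exists_esymm_mul_choose_eq_succ htpos ht
    refine ⟨u, hu, hupos, fun j hj => ?_⟩
    have hc : ((k + 1).choose j : ℝ) ≠ 0 := by
      exact_mod_cast (Nat.choose_pos (by omega)).ne'
    apply mul_left_cancel₀ hc
    linear_combination ((card s).choose j : ℝ) * h' j hj + (k.choose j : ℝ) * h j (by omega)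

theorem esymm_eq_multiset_esymm {n : ℕ} (l : Fin n → ℝ) (k : ℕ) :
    esymm l k = ((Finset.univ : Finset (Fin n)).val.map l).esymm k :=
  (Finset.esymm_map_val l Finset.univ k).symm

theorem esymm_eq_choose_of_eq_one {n : ℕ} {l : Fin n → ℝ} (hl : ∀ i, l i = 1) (k : ℕ) :
    esymm l k = n.choose k := by
  simp [esymm, hl]

theorem eq_one_of_esymm_one_two {n : ℕ} {l : Fin n → ℝ} (h1 : esymm l 1 = n)
    (h2 : esymm l 2 = n.choose 2) (i : Fin n) : l i = 1 := by
  have hs : ∑ i, l i = n := by simpa [esymm, Finset.powersetCard_one] using h1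
  have hq := Multiset.sq_sum_eq ((Finset.univ : Finset (Fin n)).val.map l)
  rw [← esymm_eq_multiset_esymm, h2, Multiset.map_map, Nat.cast_choose_two] at hq
  change (∑ i, l i) ^ 2 = ∑ i, l i ^ 2 + _ at hq
  have h0 : ∑ i, (l i - 1) ^ 2 = 0 := by
    simp only [sub_sq, one_pow, mul_one, Finset.sum_add_distrib, Finset.sum_sub_distrib,
      ← Finset.mul_sum, hs, Finset.sum_const, Finset.card_univ, Fintype.card_fin, nsmul_eq_mul]
    rw [hs] at hq
    linarith
  have := (Finset.sum_eq_zero_iff_of_nonneg fun i _ => sq_nonneg (l i - 1)).mp h0 i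
    (Finset.mem_univ i)
  exact sub_eq_zero.mp (pow_eq_zero_iff two_ne_zero |>.mp this)

theorem stmt_11 (n : ℕ) (hn : 2 ≤ n) (l : Fin n → ℝ) (hl : ∀ i, 0 < l i)
    (k : ℕ) (hk1 : 1 ≤ k) (hkn : k ≤ n) (he : esymm l k = (n.choose k : ℝ)) :
    (n.choose (k - 1) : ℝ) ≤ esymm l (k - 1) ∧
      (2 ≤ k → (esymm l (k - 1) = (n.choose (k - 1) : ℝ) ↔ ∀ i, l i = 1)) := by
  obtain ⟨m, rfl⟩ : ∃ m, k = m + 1 := ⟨k - 1, by omega⟩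
  rw [Nat.add_sub_cancel]
  have hcard : ((Finset.univ : Finset (Fin n)).val.map l).card = n := by simp
  obtain ⟨t, ht, htpos, h⟩ := ((Finset.univ : Finset (Fin n)).val.map l).exists_esymm_mul_choose_eq
    (k := m + 1) (by simpa using hl) (by rwa [hcard])
  simp only [hcard, ← esymm_eq_multiset_esymm] at h
  have hchoose : ∀ j ≤ n, (0 : ℝ) < n.choose j := fun j hj => by
    exact_mod_cast Nat.choose_pos hj
  have hprod : t.prod = 1 := by
    have := h (m + 1) le_rfl
    rw [he, ← ht, t.esymm_card, ht, Nat.choose_self, mul_comm] at this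
    exact mul_left_cancel₀ (hchoose _ hkn).ne' (by exact_mod_cast this)
  have hm := h m (by omega)
  rw [t.esymm_eq_prod_mul_sum_inv (fun x hx => (htpos x hx).ne') ht, hprod, one_mul,
    Nat.choose_succ_self_right] at hm
  push_cast at hm
  have hm0 : (0 : ℝ) < m + 1 := by positivity
  refine ⟨?_, fun hk2 => ⟨fun heq => ?_, fun hone => esymm_eq_choose_of_eq_one hone m⟩⟩
  · have hle := t.card_le_sum_map_inv htpos hprod
    rw [ht] at hle
    push_cast at hle
    have := mul_le_mul_of_nonneg_right hle (hchoose m (by omega)).le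
    rw [hm, mul_comm] at this
    exact le_of_mul_le_mul_right this hm0
  · have hsum : (t.map fun x => x⁻¹).sum = t.card := by
      rw [ht]
      push_cast
      apply mul_right_cancel₀ (hchoose m (by omega)).ne'
      rw [hm, heq, mul_comm]
    have ht1 : t = Multiset.replicate (m + 1) 1 :=
      Multiset.eq_replicate.mpr ⟨ht, t.eq_one_of_sum_map_inv_eq_card htpos hprod hsum⟩
    have hval : ∀ j ≤ m + 1, esymm l j = n.choose j := fun j hj => by
      have htj : t.esymm j = (m + 1).choose j := by
        rw [ht1, Multiset.esymm, Multiset.map_congr rfl (g := fun _ => (1 : ℝ))]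
        · simp
        · intro u hu
          exact Multiset.prod_eq_one fun x hx =>
            Multiset.eq_of_mem_replicate (Multiset.mem_of_le (Multiset.mem_powersetCard.mp hu).1 hx)
      have hj' := h j hj
      rw [htj, mul_comm] at hj'
      have : ((m + 1).choose j : ℝ) ≠ 0 := by exact_mod_cast (Nat.choose_pos hj).ne'
      exact (mul_right_cancel₀ this hj').symm
    exact eq_one_of_esymm_one_two (by simpa using hval 1 (by omega)) (hval 2 hk2)
end

section
/- Let n ≥ 2, let λ : Fin n → ℝ with λ_i > 0 for all i, let k be an integer with 2 ≤ k ≤ n, and suppose e_k(λ) = C(n,k). Then e_1(λ) ≥ n, with equality if and only if λ_i = 1 for all i. -/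
lemma bernoulli_homogeneous {m d : ℝ} (hm : 0 ≤ m) (hmd : 0 ≤ m + d) (j : ℕ) :
    m ^ j * (m + (j + 1) * d) ≤ (m + d) ^ (j + 1) := by
  induction j with
  | zero => simp
  | succ j ih =>
    have hstep := mul_le_mul_of_nonneg_right ih hmd
    have hsq : 0 ≤ m ^ j * ((j + 1) * d ^ 2) := by positivity
    rw [pow_succ (m + d)]
    push_cast
    linear_combination hstep + hsq

lemma bernoulli_homogeneous_strict {m d : ℝ} (hm : 0 < m) (hmd : 0 ≤ m + d) (hd : d ≠ 0)
    {j : ℕ} (hj : 1 ≤ j) : m ^ j * (m + (j + 1) * d) < (m + d) ^ (j + 1) := by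
  obtain ⟨j, rfl⟩ := Nat.exists_eq_add_of_le' hj
  have hstep := mul_le_mul_of_nonneg_right (bernoulli_homogeneous hm.le hmd j) hmd
  have hsq : 0 < m ^ j * ((j + 1) * d ^ 2) := by positivity
  rw [pow_succ (m + d)]
  push_cast
  linear_combination hstep + hsq

section FinsetEsymm

variable {ι : Type*} [DecidableEq ι]

lemma sum_prod_powersetCard_insert (l : ι → ℝ) {a : ι} {s : Finset ι} (ha : a ∉ s) (j : ℕ) :
    ∑ S ∈ (insert a s).powersetCard (j + 1), ∏ i ∈ S, l i =
      ∑ S ∈ s.powersetCard (j + 1), ∏ i ∈ S, l i +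
        l a * ∑ S ∈ s.powersetCard j, ∏ i ∈ S, l i := by
  have hnot {S : Finset ι} (hS : S ∈ s.powersetCard j) : a ∉ S :=
    fun h => ha ((Finset.mem_powersetCard.mp hS).1 h)
  rw [Finset.powersetCard_succ_insert ha, Finset.sum_union, Finset.sum_image, Finset.mul_sum]
  · congr 1
    exact Finset.sum_congr rfl fun S hS => Finset.prod_insert (hnot hS)
  · intro S hS T hT hST
    rw [← Finset.erase_insert (hnot hS), ← Finset.erase_insert (hnot hT), hST]
  · rw [Finset.disjoint_left]
    intro S hS hS'
    obtain ⟨T, -, rfl⟩ := Finset.mem_image.mp hS'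
    exact ha ((Finset.mem_powersetCard.mp hS).1 (Finset.mem_insert_self a T))

lemma sum_div_card_insert (l : ι → ℝ) {a : ι} {s : Finset ι} (ha : a ∉ s) :
    (∑ i ∈ insert a s, l i) / (insert a s).card =
      (∑ i ∈ s, l i) / s.card + (l a - (∑ i ∈ s, l i) / s.card) / (s.card + 1) := by
  rw [Finset.sum_insert ha, Finset.card_insert_of_notMem ha]
  rcases s.eq_empty_or_nonempty with rfl | hs
  · simp
  · have : (s.card : ℝ) ≠ 0 := by exact_mod_cast hs.card_pos.ne'
    push_cast
    field_simp
    ring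

/-- Bounding the elementary symmetric sums of `s` by those of its mean bounds the sum of
`insert a s` by the linearization at that mean. -/
lemma sum_prod_powersetCard_insert_le (l : ι → ℝ) {a : ι} {s : Finset ι} (ha : a ∉ s)
    (hla : 0 ≤ l a) {m : ℝ}
    (h : ∀ k, ∑ S ∈ s.powersetCard k, ∏ i ∈ S, l i ≤ s.card.choose k * m ^ k) (j : ℕ) :
    ∑ S ∈ (insert a s).powersetCard (j + 1), ∏ i ∈ S, l i ≤
      ((s.card + 1).choose (j + 1) : ℝ) *
        (m ^ j * (m + (j + 1) * ((l a - m) / (s.card + 1)))) := by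
  rw [sum_prod_powersetCard_insert l ha]
  refine (add_le_add (h (j + 1)) (mul_le_mul_of_nonneg_left (h j) hla)).trans_eq ?_
  have hpascal : ((s.card + 1).choose (j + 1) : ℝ) = s.card.choose j + s.card.choose (j + 1) := by
    exact_mod_cast Nat.choose_succ_succ _ _
  have habsorb : ((s.card : ℝ) + 1) * s.card.choose j =
      (s.card + 1).choose (j + 1) * (j + 1) := by
    exact_mod_cast Nat.add_one_mul_choose_eq s.card j
  have hd : ((s.card : ℝ) + 1) * ((l a - m) / (s.card + 1)) = l a - m :=
    mul_div_cancel₀ _ (by positivity)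
  linear_combination (-m ^ (j + 1)) * hpascal + m ^ j * ((l a - m) / (s.card + 1)) * habsorb -
    m ^ j * s.card.choose j * hd

/-- Maclaurin's inequality between the mean and the `k`-th elementary symmetric sum. -/
lemma sum_prod_powersetCard_le (l : ι → ℝ) (hl : ∀ i, 0 ≤ l i) (s : Finset ι) (k : ℕ) :
    ∑ S ∈ s.powersetCard k, ∏ i ∈ S, l i ≤
      s.card.choose k * ((∑ i ∈ s, l i) / s.card) ^ k := by
  induction s using Finset.induction_on generalizing k with
  | empty =>
    cases k with
    | zero => simp
    | succ j => rw [Finset.powersetCard_eq_empty.mpr (by simp)]; simp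
  | insert a s ha ih =>
    cases k with
    | zero => simp
    | succ j =>
      have hmean (t : Finset ι) : 0 ≤ (∑ i ∈ t, l i) / t.card :=
        div_nonneg (Finset.sum_nonneg fun i _ => hl i) (Nat.cast_nonneg _)
      have hmean' := hmean (insert a s)
      rw [sum_div_card_insert l ha] at hmean' ⊢
      rw [Finset.card_insert_of_notMem ha]
      exact (sum_prod_powersetCard_insert_le l ha (hl a) ih j).trans
        (mul_le_mul_of_nonneg_left (bernoulli_homogeneous (hmean s) hmean' j) (Nat.cast_nonneg _))

/-- In the equality case of Maclaurin's inequality every value is the mean. -/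
lemma eq_mean_of_sum_prod_powersetCard_eq (l : ι → ℝ) (hl : ∀ i, 0 < l i) {s : Finset ι} {k : ℕ}
    (hk : 2 ≤ k) (hks : k ≤ s.card)
    (h : ∑ S ∈ s.powersetCard k, ∏ i ∈ S, l i =
      s.card.choose k * ((∑ i ∈ s, l i) / s.card) ^ k)
    {a : ι} (ha : a ∈ s) : l a = (∑ i ∈ s, l i) / s.card := by
  obtain ⟨t, hat, rfl⟩ : ∃ t, a ∉ t ∧ insert a t = s :=
    ⟨s.erase a, Finset.notMem_erase a s, Finset.insert_erase ha⟩
  obtain ⟨j, rfl⟩ := Nat.exists_eq_add_of_le' (one_le_two.trans hk)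
  have hcard := Finset.card_insert_of_notMem hat
  have ht : t.Nonempty := Finset.card_pos.mp (by omega)
  have hm : 0 < (∑ i ∈ t, l i) / t.card :=
    div_pos (Finset.sum_pos (fun i _ => hl i) ht) (by exact_mod_cast ht.card_pos)
  have hmean : 0 ≤ (∑ i ∈ insert a t, l i) / (insert a t).card :=
    div_nonneg (Finset.sum_nonneg fun i _ => (hl i).le) (Nat.cast_nonneg _)
  have hle := sum_prod_powersetCard_insert_le l hat (hl a).le
    (sum_prod_powersetCard_le l (fun i => (hl i).le) t) j
  rw [sum_div_card_insert l hat] at h hmean ⊢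
  rw [hcard] at h hks
  generalize (∑ i ∈ t, l i) / t.card = m at *
  rcases eq_or_ne ((l a - m) / ((t.card : ℝ) + 1)) 0 with hd | hd
  · have hne : (t.card : ℝ) + 1 ≠ 0 := by positivity
    rw [hd]
    linarith [(div_eq_zero_iff.mp hd).resolve_right hne]
  · have hpos : (0 : ℝ) < (t.card + 1).choose (j + 1) := by
      exact_mod_cast Nat.choose_pos hks
    have hlt := mul_lt_mul_of_pos_left
      (bernoulli_homogeneous_strict hm hmean hd (j := j) (by omega)) hpos
    linarith

end FinsetEsymm

theorem stmt_13 (n : ℕ) (hn : 2 ≤ n) (l : Fin n → ℝ) (hl : ∀ i, 0 < l i)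
    (k : ℕ) (hk2 : 2 ≤ k) (hkn : k ≤ n) (he : esymm l k = (n.choose k : ℝ)) :
    (n : ℝ) ≤ esymm l 1 ∧ (esymm l 1 = (n : ℝ) ↔ ∀ i, l i = 1) := by
  have hn0 : (0 : ℝ) < n := by exact_mod_cast (by omega : 0 < n)
  have hsum : esymm l 1 = ∑ i, l i := by simp [esymm, Finset.powersetCard_one]
  have hpos : (0 : ℝ) < n.choose k := by exact_mod_cast Nat.choose_pos hkn
  rw [hsum]
  refine ⟨?_, fun h i => ?_, fun h => by simp [h]⟩
  · have hle := sum_prod_powersetCard_le l (fun i => (hl i).le) Finset.univ k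
    rw [← esymm, he, Finset.card_univ, Fintype.card_fin] at hle
    by_contra! hlt
    have hpow : ((∑ i, l i) / n) ^ k < 1 :=
      pow_lt_one₀ (div_nonneg (Finset.sum_nonneg fun i _ => (hl i).le) hn0.le)
        ((div_lt_one hn0).mpr hlt) (by omega)
    nlinarith
  · have hmean : (∑ i, l i) / ((Finset.univ : Finset (Fin n)).card : ℝ) = 1 := by
      rw [h, Finset.card_univ, Fintype.card_fin, div_self hn0.ne']
    rw [eq_mean_of_sum_prod_powersetCard_eq l hl hk2 (by simpa using hkn) _ (Finset.mem_univ i),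
      hmean]
    rw [hmean, ← esymm, he]
    simp
end

section
/- Let n ≥ 2, let λ : Fin n → ℝ with λ_i > 0 for all i, let k be an integer with 1 ≤ k ≤ n, and suppose e_k(λ) = C(n,k). Then e_1(λ)·e_k(λ) − (k+1)·e_{k+1}(λ) − k·e_k(λ) ≥ 0, with equality if and only if λ_i = 1 for all i. -/
theorem sum_powersetCard_sum_compl_mul_prod {ι : Type*} [Fintype ι] [DecidableEq ι]
    (l : ι → ℝ) (k : ℕ) :
    ∑ S ∈ (Finset.univ : Finset ι).powersetCard k, ∑ i ∈ Sᶜ, l i * ∏ j ∈ S, l j =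
      (k + 1) * ∑ T ∈ (Finset.univ : Finset ι).powersetCard (k + 1), ∏ j ∈ T, l j := by
  have hT : (k + 1) * ∑ T ∈ (Finset.univ : Finset ι).powersetCard (k + 1), ∏ j ∈ T, l j =
      ∑ T ∈ (Finset.univ : Finset ι).powersetCard (k + 1), ∑ _i ∈ T, ∏ j ∈ T, l j := by
    rw [Finset.mul_sum]
    refine Finset.sum_congr rfl fun T hT => ?_
    simp [(Finset.mem_powersetCard.1 hT).2]
  rw [hT, Finset.sum_sigma', Finset.sum_sigma']
  refine Finset.sum_bij' (fun x _ => ⟨insert x.2 x.1, x.2⟩) (fun x _ => ⟨x.1.erase x.2, x.2⟩)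
    ?_ ?_ ?_ ?_ ?_
  · rintro ⟨S, i⟩ h
    simp only [Finset.mem_sigma, Finset.mem_powersetCard, Finset.mem_compl] at h
    simp [h.1.2, h.2]
  · rintro ⟨T, i⟩ h
    simp only [Finset.mem_sigma, Finset.mem_powersetCard] at h
    simp [h.1.2, h.2]
  · rintro ⟨S, i⟩ h
    simp only [Finset.mem_sigma, Finset.mem_compl] at h
    simp [h.2]
  · rintro ⟨T, i⟩ h
    simp only [Finset.mem_sigma] at h
    simp [h.2]
  · rintro ⟨S, i⟩ h
    simp only [Finset.mem_sigma, Finset.mem_compl] at h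
    simp [h.2]

theorem esymm_one_mul_esymm_sub {n : ℕ} (l : Fin n → ℝ) (k : ℕ) :
    esymm l 1 * esymm l k - (k + 1) * esymm l (k + 1) - k * esymm l k =
      ∑ S ∈ (Finset.univ : Finset (Fin n)).powersetCard k,
        (∏ i ∈ S, l i) * ∑ i ∈ S, (l i - 1) := by
  have h1 : esymm l 1 = ∑ i, l i := by
    simp [esymm, Finset.powersetCard_one]
  rw [h1]
  unfold esymm
  rw [← sum_powersetCard_sum_compl_mul_prod, Finset.mul_sum, Finset.mul_sum,
    ← Finset.sum_sub_distrib, ← Finset.sum_sub_distrib]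
  refine Finset.sum_congr rfl fun S hS => ?_
  rw [← Finset.sum_add_sum_compl S l, ← Finset.sum_mul, Finset.sum_sub_distrib]
  simp only [Finset.sum_const, (Finset.mem_powersetCard.1 hS).2, nsmul_eq_mul, mul_one]
  ring

theorem prod_sub_one_le_prod_mul_log {ι : Type*} (S : Finset ι) (l : ι → ℝ)
    (hl : ∀ i ∈ S, 0 < l i) :
    (∏ i ∈ S, l i) - 1 ≤ (∏ i ∈ S, l i) * ∑ i ∈ S, Real.log (l i) := by
  have hp : 0 < ∏ i ∈ S, l i := Finset.prod_pos hl
  rw [← Real.log_prod fun i hi => (hl i hi).ne']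
  have h := mul_le_mul_of_nonneg_left (Real.one_sub_inv_le_log_of_pos hp) hp.le
  rwa [mul_sub, mul_one, mul_inv_cancel₀ hp.ne'] at h

theorem prod_sub_one_le_prod_mul_sum_sub_one {ι : Type*} (S : Finset ι) (l : ι → ℝ)
    (hl : ∀ i ∈ S, 0 < l i) :
    (∏ i ∈ S, l i) - 1 ≤ (∏ i ∈ S, l i) * ∑ i ∈ S, (l i - 1) :=
  (prod_sub_one_le_prod_mul_log S l hl).trans <|
    mul_le_mul_of_nonneg_left
      (Finset.sum_le_sum fun i hi => Real.log_le_sub_one_of_pos (hl i hi))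
      (Finset.prod_pos hl).le

theorem eq_one_of_prod_mul_sum_sub_one_eq {ι : Type*} (S : Finset ι) (l : ι → ℝ)
    (hl : ∀ i ∈ S, 0 < l i)
    (h : (∏ i ∈ S, l i) - 1 = (∏ i ∈ S, l i) * ∑ i ∈ S, (l i - 1)) :
    ∀ i ∈ S, l i = 1 := by
  by_contra! hne
  obtain ⟨i, hi, hi1⟩ := hne
  have hlt : ∑ i ∈ S, Real.log (l i) < ∑ i ∈ S, (l i - 1) :=
    Finset.sum_lt_sum (fun j hj => Real.log_le_sub_one_of_pos (hl j hj))
      ⟨i, hi, Real.log_lt_sub_one_of_pos (hl i hi) hi1⟩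
  have h1 := mul_lt_mul_of_pos_left hlt (Finset.prod_pos hl)
  have h2 := prod_sub_one_le_prod_mul_log S l hl
  linarith

theorem stmt_14 (n : ℕ) (hn : 2 ≤ n) (l : Fin n → ℝ) (hl : ∀ i, 0 < l i)
    (k : ℕ) (hk1 : 1 ≤ k) (hkn : k ≤ n) (he : esymm l k = (n.choose k : ℝ)) :
    0 ≤ esymm l 1 * esymm l k - (k + 1) * esymm l (k + 1) - k * esymm l k ∧
      (esymm l 1 * esymm l k - (k + 1) * esymm l (k + 1) - k * esymm l k = 0 ↔
        ∀ i, l i = 1) := by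
  rw [esymm_one_mul_esymm_sub]
  have hsum : ∑ S ∈ (Finset.univ : Finset (Fin n)).powersetCard k, ((∏ i ∈ S, l i) - 1) = 0 := by
    rw [Finset.sum_sub_distrib]
    change esymm l k - _ = 0
    simp [he]
  have hle : ∀ S ∈ (Finset.univ : Finset (Fin n)).powersetCard k,
      (∏ i ∈ S, l i) - 1 ≤ (∏ i ∈ S, l i) * ∑ i ∈ S, (l i - 1) := fun S _ =>
    prod_sub_one_le_prod_mul_sum_sub_one S l fun i _ => hl i
  refine ⟨hsum ▸ Finset.sum_le_sum hle, fun h i => ?_, fun h => by simp [h]⟩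
  obtain ⟨S, hiS, -, hS⟩ := Finset.exists_subsuperset_card_eq
    (Finset.subset_univ {i}) (by simpa using hk1) (by simpa using hkn)
  exact eq_one_of_prod_mul_sum_sub_one_eq S l (fun j _ => hl j)
    ((Finset.sum_eq_sum_iff_of_le hle).1 (hsum.trans h.symm) S
      (Finset.mem_powersetCard.2 ⟨Finset.subset_univ S, hS⟩)) i (hiS (Finset.mem_singleton_self i))
end
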